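/- arXiv:2208.09854 — 4 statements merged into one kernel-verified Lean document; each statement's English description precedes it below -/
import Mathlib

section
/- For every independent family 𝓘 of subsets of ω, fil(𝓘) = ⋃{ fil(𝓙) : 𝓙 ⊆ 𝓘 and 𝓙 is countable }. -/
open Set

/-- Finite partial functions from `I` to `{0,1}`, coded as functions
`Set ℕ → Option Bool` with finite support contained in `I`. -/
def FF (I : Set (Set ℕ)) : Set (Set ℕ → Option Bool) :=
  {g | (∀ A, g A ≠ none → A ∈ I) ∧ {A | g A ≠ none}.Finite}

/-- The Boolean combination `𝓘^g`: intersection of all `A` with `g A = 1`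
and all `ω ∖ A` with `g A = 0` (equal to `ω` when `g` is empty). -/
def BoolComb (g : Set ℕ → Option Bool) : Set ℕ :=
  {n | ∀ A : Set ℕ, (g A = some true → n ∈ A) ∧ (g A = some false → n ∉ A)}

/-- `g` extends `g'` as a partial function. -/
def Extends (g g' : Set ℕ → Option Bool) : Prop :=
  ∀ A b, g' A = some b → g A = some b

/-- `I` is an independent family. -/
def Indep (I : Set (Set ℕ)) : Prop :=
  ∀ g ∈ FF I, (BoolComb g).Infinite

/-- The density filter `fil(𝓘)`. -/
def densityFilter (I : Set (Set ℕ)) : Set (Set ℕ) :=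
  {X | ∀ g' ∈ FF I, ∃ g ∈ FF I, Extends g g' ∧ (BoolComb g \ X).Finite}

/-- The density ideal `id(𝓘)`. -/
def densityIdeal (I : Set (Set ℕ)) : Set (Set ℕ) :=
  {X | ∀ g' ∈ FF I, ∃ g ∈ FF I, Extends g g' ∧ (BoolComb g ∩ X).Finite}

/-- `I` is densely maximal. -/
def DenselyMaximal (I : Set (Set ℕ)) : Prop :=
  ∀ X : Set ℕ, X.Infinite → ∀ g' ∈ FF I, ∃ g ∈ FF I, Extends g g' ∧
    ((BoolComb g ∩ X).Finite ∨ (BoolComb g \ X).Finite)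

theorem FF_mono {J K : Set (Set ℕ)} (h : J ⊆ K) : FF J ⊆ FF K :=
  fun _ hg => ⟨fun A hA => h (hg.1 A hA), hg.2⟩

theorem BoolComb_anti {g g' : Set ℕ → Option Bool} (h : Extends g g') :
    BoolComb g ⊆ BoolComb g' :=
  fun _ hn A => ⟨fun hA => (hn A).1 (h A _ hA), fun hA => (hn A).2 (h A _ hA)⟩

/-- There are only countably many finite partial functions on a countable family. -/
theorem countable_FF {J : Set (Set ℕ)} (hJ : J.Countable) : (FF J).Countable := by
  have hgraph : MapsTo (fun (g : Set ℕ → Option Bool) => {p : Set ℕ × Bool | g p.1 = some p.2})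
      (FF J) {t | t.Finite ∧ t ⊆ J ×ˢ (univ : Set Bool)} := by
    intro g hg
    refine ⟨(hg.2.prod (finite_univ (α := Bool))).subset ?_, ?_⟩
    · rintro ⟨A, b⟩ h
      have h' : g A = some b := h
      simp [h']
    · rintro ⟨A, b⟩ h
      have h' : g A = some b := h
      exact ⟨hg.1 A (by simp [h']), mem_univ _⟩
  refine hgraph.countable_of_injOn ?_
    (countable_ofPred_finite_subset (hJ.prod (countable_univ (α := Bool))))
  intro g _ g' _ h
  funext A
  ext b
  exact Set.ext_iff.1 h (A, b)

/-- The density filter grows with the family. -/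
theorem densityFilter_mono {J K : Set (Set ℕ)} (h : J ⊆ K) :
    densityFilter J ⊆ densityFilter K := by
  classical
  intro X hX g' hg'
  obtain ⟨g, hg, hext, hfin⟩ := hX (fun A => if A ∈ J then g' A else none)
    ⟨fun A hA => by by_contra hn; simp [hn] at hA,
      hg'.2.subset fun A (hA : (if A ∈ J then g' A else none) ≠ none) => by
        by_cases hn : A ∈ J <;> simp_all⟩
  have hgJ : ∀ A, A ∉ J → g A = none := fun A hA => by
    by_contra hn
    exact hA (hg.1 A hn)
  refine ⟨fun A => if A ∈ J then g A else g' A, ⟨fun A hA => ?_, ?_⟩, fun A b hb => ?_,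
    hfin.subset (sdiff_subset_sdiff_left (BoolComb_anti fun A b hb => ?_))⟩
  · by_cases hn : A ∈ J
    · exact h hn
    · exact hg'.1 A (by simpa [hn] using hA)
  · refine (hg.2.union hg'.2).subset fun A (hA : (if A ∈ J then g A else g' A) ≠ none) => ?_
    by_cases hn : A ∈ J
    · exact Or.inl (by simpa [hn] using hA)
    · exact Or.inr (by simpa [hn] using hA)
  · by_cases hn : A ∈ J
    · simpa [hn] using hext A b (by simpa [hn] using hb)
    · simpa [hn] using hb
  · by_cases hn : A ∈ J
    · simpa [hn] using hb
    · simp [hgJ A hn] at hb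

/-- A finite partial function on the union of an increasing sequence lives on one of its terms. -/
theorem exists_mem_FF_of_mem_FF_iUnion {J : ℕ → Set (Set ℕ)} (hJ : Monotone J)
    {g : Set ℕ → Option Bool} (hg : g ∈ FF (⋃ n, J n)) : ∃ n, g ∈ FF (J n) := by
  have hmem : ∀ A, ∃ n, g A ≠ none → A ∈ J n := fun A => by
    by_cases hA : g A = none
    · exact ⟨0, fun h => absurd hA h⟩
    · obtain ⟨n, hn⟩ := mem_iUnion.1 (hg.1 A hA)
      exact ⟨n, fun _ => hn⟩
  choose k hk using hmem
  obtain ⟨n, hn⟩ := (hg.2.image k).bddAbove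
  exact ⟨n, fun A hA => hJ (hn (mem_image_of_mem k hA)) (hk A hA), hg.2⟩

/-- A map of finite partial functions on `I`
preserves `FF J` for some countable `J ⊆ I`. -/
theorem exists_countable_mapsTo_FF {I : Set (Set ℕ)}
    {w : (Set ℕ → Option Bool) → (Set ℕ → Option Bool)} (hw : MapsTo w (FF I) (FF I)) :
    ∃ J ⊆ I, J.Countable ∧ MapsTo w (FF J) (FF J) := by
  let F : Set (Set ℕ) → Set (Set ℕ) := fun J => J ∪ ⋃ g ∈ FF J, {A | w g A ≠ none}
  let J : ℕ → Set (Set ℕ) := fun n => F^[n] ∅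
  have hsucc : ∀ n, J (n + 1) = F (J n) := fun n => Function.iterate_succ_apply' F n ∅
  have hmono : Monotone J := monotone_nat_of_le_succ fun n => by
    rw [hsucc]
    exact subset_union_left
  have hsub : ∀ n, J n ⊆ I := fun n => by
    induction n with
    | zero => exact empty_subset I
    | succ n ih =>
      rw [hsucc]
      exact union_subset ih (iUnion₂_subset fun g hg => (hw (FF_mono ih hg)).1)
  have hcount : ∀ n, (J n).Countable := fun n => by
    induction n with
    | zero => exact countable_empty
    | succ n ih =>
      rw [hsucc]
      refine ih.union ((countable_FF ih).biUnion fun g hg => ?_)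
      exact (hw (FF_mono (hsub n) hg)).2.countable
  refine ⟨⋃ n, J n, iUnion_subset hsub, countable_iUnion hcount, fun g hg => ?_⟩
  obtain ⟨n, hn⟩ := exists_mem_FF_of_mem_FF_iUnion hmono hg
  refine ⟨fun A hA => mem_iUnion.2 ⟨n + 1, ?_⟩, (hw (FF_mono (hsub n) hn)).2⟩
  rw [hsucc]
  exact Or.inr (mem_biUnion hn hA)

theorem stmt2 (I : Set (Set ℕ)) (hI : Indep I) :
    densityFilter I =
      ⋃ J ∈ {J : Set (Set ℕ) | J ⊆ I ∧ J.Countable}, densityFilter J := by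
  refine Subset.antisymm (fun X hX => ?_) (iUnion₂_subset fun J hJ => densityFilter_mono hJ.1)
  choose! w hw hext hfin using hX
  obtain ⟨J, hJI, hJc, hJw⟩ := exists_countable_mapsTo_FF (w := w) (I := I) fun g hg => hw g hg
  refine mem_biUnion (show J ∈ {J : Set (Set ℕ) | J ⊆ I ∧ J.Countable} from ⟨hJI, hJc⟩) ?_
  exact fun g hg => ⟨w g, hJw hg, hext g (FF_mono hJI hg), hfin g (FF_mono hJI hg)⟩
end

section
/- An independent family 𝓘 of subsets of ω is densely maximal if and only if every X ⊆ ω either belongs to fil(𝓘) or satisfies X ⊆* ω∖𝓘^g for some g ∈ FF(𝓘). -/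
open Set

theorem empty_mem_FF (I : Set (Set ℕ)) : (fun _ => none) ∈ FF I := by
  simp [FF]

theorem or_mem_FF {I : Set (Set ℕ)} {g h : Set ℕ → Option Bool} (hg : g ∈ FF I) (hh : h ∈ FF I) :
    (fun A => (g A).or (h A)) ∈ FF I := by
  have support_or : ∀ A, (g A).or (h A) ≠ none → g A ≠ none ∨ h A ≠ none := by
    intro A hA
    cases hgA : g A <;> simp_all
  exact ⟨fun A hA => (support_or A hA).elim (hg.1 A) (hh.1 A),
    (hg.2.union hh.2).subset support_or⟩

theorem or_extends_left (g h : Set ℕ → Option Bool) : Extends (fun A => (g A).or (h A)) g := by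
  intro A b hA
  simp [hA]

/-- Compatibility of `g` and `h` follows from their Boolean combinations meeting. -/
theorem or_extends_right {g h : Set ℕ → Option Bool} {n : ℕ}
    (hng : n ∈ BoolComb g) (hnh : n ∈ BoolComb h) : Extends (fun A => (g A).or (h A)) h := by
  intro A b hA
  have hgA := hng A
  have hhA := hnh A
  rcases hg : g A with _ | _ | _ <;> cases b <;> simp_all

theorem stmt3 (I : Set (Set ℕ)) (hI : Indep I) :
    DenselyMaximal I ↔
      ∀ X : Set ℕ, X ∈ densityFilter I ∨
        ∃ g ∈ FF I, (X \ (BoolComb g)ᶜ).Finite := by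
  constructor
  · intro hmax X
    by_cases hX : X.Infinite
    · by_cases hfil : X ∈ densityFilter I
      · exact Or.inl hfil
      · simp only [densityFilter, mem_ofPred_eq, not_forall, not_exists, not_and] at hfil
        obtain ⟨g', hg', hbad⟩ := hfil
        obtain ⟨g, hg, hext, hfin | hfin⟩ := hmax X hX g' hg'
        · exact Or.inr ⟨g, hg, by rwa [sdiff_compl, inter_comm]⟩
        · exact absurd hfin (hbad g hg hext)
    · exact Or.inr ⟨_, empty_mem_FF I, (not_infinite.1 hX).subset sdiff_subset⟩
  · intro h X _ g' hg'
    rcases h (X ∪ (BoolComb g')ᶜ) with hfil | ⟨k, hk, hfin⟩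
    · obtain ⟨g, hg, hext, hfin⟩ := hfil g' hg'
      exact ⟨g, hg, hext, Or.inr (hfin.subset fun n hn =>
        ⟨hn.1, fun hnX => hnX.elim hn.2 fun hng => hng (BoolComb_anti hext hn.1)⟩)⟩
    · rw [sdiff_compl] at hfin
      obtain ⟨n, hnk, hn⟩ := (hI k hk).exists_notMem_finite hfin
      have hng' : n ∈ BoolComb g' := by
        by_contra hng
        exact hn ⟨Or.inr hng, hnk⟩
      have hext := or_extends_right hng' hnk
      exact ⟨_, or_mem_FF hg' hk, or_extends_left g' k, Or.inl (hfin.subset fun m hm =>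
        ⟨Or.inl hm.2, BoolComb_anti hext hm.1⟩)⟩
end

section
/- Let 𝓘 be an infinite independent family of subsets of ω. Then for every X ⊆ ω, X ∈ fil(𝓘) if and only if for every g' ∈ FF(𝓘) there is g ∈ FF(𝓘) with g ⊇ g' and 𝓘^g ⊆ X. In other words, for infinite independent families the meaning of the density filter is unchanged if 'finite' is replaced by 'empty'. -/
open Set

theorem BoolComb.anti {g h : Set ℕ → Option Bool} (hgh : Extends h g) :
    BoolComb h ⊆ BoolComb g :=
  fun _ hn A => ⟨fun hA => (hn A).1 (hgh A _ hA), fun hA => (hn A).2 (hgh A _ hA)⟩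

theorem Extends.trans {f g h : Set ℕ → Option Bool} (hfg : Extends f g) (hgh : Extends g h) :
    Extends f h :=
  fun A b hA => hfg A b (hgh A b hA)

/-- Over an infinite family, any `g` extends to some `h` whose Boolean combination omits `n`. -/
theorem exists_extends_notMem_boolComb {I : Set (Set ℕ)} (hinf : I.Infinite)
    {g : Set ℕ → Option Bool} (hg : g ∈ FF I) (n : ℕ) :
    ∃ h ∈ FF I, Extends h g ∧ n ∉ BoolComb h := by
  classical
  obtain ⟨A, hAI, hA⟩ := hinf.exists_notMem_finite hg.2
  have hgA : g A = none := by simpa using hA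
  refine ⟨Function.update g A (some (decide (n ∉ A))), ⟨fun B hB => ?_, ?_⟩, fun B b hB => ?_,
    fun hn => ?_⟩
  · by_cases hBA : B = A
    · exact hBA ▸ hAI
    · exact hg.1 B (by simpa [hBA] using hB)
  · refine (hg.2.insert A).subset fun B hB => ?_
    by_cases hBA : B = A
    · exact Or.inl hBA
    · exact Or.inr (by simpa [hBA] using hB)
  · have hBA : B ≠ A := by
      rintro rfl
      simp [hgA] at hB
    simpa [hBA] using hB
  · have := hn A
    by_cases hnA : n ∈ A <;> simp [hnA] at this

/-- Over an infinite family, any `g` extends to some `h` whose Boolean combination avoids a given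
finite set. -/
theorem exists_extends_disjoint_boolComb {I : Set (Set ℕ)} (hinf : I.Infinite)
    {g : Set ℕ → Option Bool} (hg : g ∈ FF I) {F : Set ℕ} (hF : F.Finite) :
    ∃ h ∈ FF I, Extends h g ∧ Disjoint (BoolComb h) F := by
  induction F, hF using Set.Finite.induction_on with
  | empty => exact ⟨g, hg, fun _ _ hA => hA, disjoint_empty _⟩
  | @insert n F _ _ ih =>
    obtain ⟨h, hh, hhg, hd⟩ := ih
    obtain ⟨k, hk, hkh, hn⟩ := exists_extends_notMem_boolComb hinf hh n
    exact ⟨k, hk, hkh.trans hhg,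
      disjoint_insert_right.2 ⟨hn, hd.mono_left (BoolComb.anti hkh)⟩⟩

theorem stmt6 (I : Set (Set ℕ)) (hI : Indep I) (hinf : I.Infinite) :
    ∀ X : Set ℕ, X ∈ densityFilter I ↔
      ∀ g' ∈ FF I, ∃ g ∈ FF I, Extends g g' ∧ BoolComb g ⊆ X := by
  intro X
  constructor
  · intro hX g' hg'
    obtain ⟨g, hg, hgg', hfin⟩ := hX g' hg'
    obtain ⟨h, hh, hhg, hd⟩ := exists_extends_disjoint_boolComb hinf hg hfin
    refine ⟨h, hh, hhg.trans hgg', fun n hn => ?_⟩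
    by_contra hnX
    exact disjoint_left.1 hd hn ⟨BoolComb.anti hhg hn, hnX⟩
  · intro hX g' hg'
    obtain ⟨g, hg, hgg', hsub⟩ := hX g' hg'
    exact ⟨g, hg, hgg', by simp [sdiff_eq_empty.2 hsub]⟩
end

section
/- Let 𝓕 be a filter on ω containing all cofinite sets, all of whose elements are infinite. Then 𝓕 is a Q-set if and only if for every strictly increasing function f : ω → ω there is C ∈ 𝓕 such that, letting {k_n : n < ω} be the strictly increasing enumeration of C, f(k_n) < k_{n+1} holds for all n < ω. -/
open Set

/-- `F` is a Q-set: every partition of `ω` into finite sets admits a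
semiselector in `F`. -/
def QSet (F : Set (Set ℕ)) : Prop :=
  ∀ p : ℕ → Set ℕ, (∀ n, (p n).Finite) →
    Pairwise (Function.onFun Disjoint p) → (⋃ n, p n) = Set.univ →
    ∃ A ∈ F, ∀ n, (A ∩ p n).Subsingleton

/-- A Q-set contains a set on which a given finite-to-one function is injective. -/
theorem QSet.exists_injOn {F : Set (Set ℕ)} (hF : QSet F) (h : ℕ → ℕ)
    (hfin : ∀ n, (h ⁻¹' {n}).Finite) : ∃ A ∈ F, InjOn h A := by
  obtain ⟨A, hA, hsub⟩ := hF (fun n => h ⁻¹' {n}) hfin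
    (fun m n hmn => (disjoint_singleton.2 hmn).preimage h)
    (eq_univ_of_forall fun x => mem_iUnion.2 ⟨h x, rfl⟩)
  exact ⟨A, hA, fun x hx y hy hxy => hsub (h y) ⟨hx, hxy⟩ ⟨hy, rfl⟩⟩

/-- The enumeration of an infinite set outgrows a function at every step if and only if any two
elements of the set are separated by the function. -/
theorem forall_nth_lt_nth_succ_iff {C : Set ℕ} (hC : C.Infinite) (f : ℕ → ℕ) :
    (∀ n, f (Nat.nth (· ∈ C) n) < Nat.nth (· ∈ C) (n + 1)) ↔
      ∀ i ∈ C, ∀ j ∈ C, i < j → f i < j := by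
  have hmono : StrictMono (Nat.nth (· ∈ C)) := Nat.nth_strictMono hC
  have hmem : ∀ n, Nat.nth (· ∈ C) n ∈ C := Nat.nth_mem_of_infinite hC
  have hrange : ∀ i ∈ C, ∃ n, Nat.nth (· ∈ C) n = i := fun i hi =>
    (Nat.range_nth_of_infinite hC).symm.subset hi
  constructor
  · intro h i hi j hj hij
    obtain ⟨m, rfl⟩ := hrange i hi
    obtain ⟨n, rfl⟩ := hrange j hj
    exact (h m).trans_le (hmono.monotone (hmono.lt_iff_lt.1 hij))
  · exact fun h n => h _ (hmem n) _ (hmem _) (hmono n.lt_succ_self)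

/-- For a strictly increasing `f` there is a monotone finite-to-one function `g` such that `f i < j`
as soon as `g j` exceeds `g i` by at least two. -/
theorem exists_monotone_finite_fibers_of_strictMono {f : ℕ → ℕ} (hf : StrictMono f) :
    ∃ g : ℕ → ℕ, Monotone g ∧ (∀ n, {x | g x ≤ n}.Finite) ∧
      ∀ i j, g i + 2 ≤ g j → f i < j := by
  classical
  let a : ℕ → ℕ := fun m => (fun x => f x + 1)^[m] 0
  have ha : ∀ m, a (m + 1) = f (a m) + 1 := fun m => Function.iterate_succ_apply' _ _ _
  have hmono : StrictMono a := strictMono_nat_of_lt_succ fun m => by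
    rw [ha]
    exact Nat.lt_succ_of_le (hf.id_le _)
  have hex : ∀ x, ∃ m, x ≤ a m := fun x => ⟨x, hmono.id_le x⟩
  refine ⟨fun x => Nat.find (hex x), fun x y hxy => ?_, fun n => ?_, fun i j hij => ?_⟩
  · exact Nat.find_min' _ (hxy.trans (Nat.find_spec (hex y)))
  · exact (finite_Iic (a n)).subset fun x hx =>
      (Nat.find_spec (hex x)).trans (hmono.monotone hx)
  · have hj : a (Nat.find (hex i) + 1) < j :=
      not_le.1 (Nat.find_min (hex j) (by simp only at hij; omega))
    have hi : f i ≤ f (a (Nat.find (hex i))) := hf.monotone (Nat.find_spec (hex i))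
    rw [ha] at hj
    omega

/-- For a finite-to-one function `h` there is a strictly increasing function bounding, at every `i`,
the fiber of `h` through `i`. -/
theorem exists_strictMono_bound_fibers (h : ℕ → ℕ) (hfin : ∀ n, (h ⁻¹' {n}).Finite) :
    ∃ f : ℕ → ℕ, StrictMono f ∧ ∀ i j, h i = h j → j ≤ f i := by
  choose b hb using fun n => (hfin n).bddAbove
  refine ⟨fun i => ∑ k ∈ Finset.range (i + 1), (b (h k) + 1),
    strictMono_nat_of_lt_succ fun i => ?_, fun i j hij => ?_⟩
  · rw [Finset.sum_range_succ _ (i + 1)]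
    omega
  · have hj : j ≤ b (h i) := hb (h i) hij.symm
    simp only [Finset.sum_range_succ _ i]
    omega

theorem stmt8 (F : Set (Set ℕ))
    (hup : ∀ X ∈ F, ∀ Y : Set ℕ, X ⊆ Y → Y ∈ F)
    (hinter : ∀ X ∈ F, ∀ Y ∈ F, X ∩ Y ∈ F)
    (hcofin : ∀ X : Set ℕ, Xᶜ.Finite → X ∈ F)
    (hinf : ∀ X ∈ F, X.Infinite) :
    QSet F ↔
      ∀ f : ℕ → ℕ, StrictMono f → ∃ C ∈ F,
        ∀ n : ℕ, f (Nat.nth (· ∈ C) n) < Nat.nth (· ∈ C) (n + 1) := by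
  constructor
  · intro hF f hf
    obtain ⟨g, hg, hfin, hsep⟩ := exists_monotone_finite_fibers_of_strictMono hf
    obtain ⟨A, hA, hinjA⟩ := hF.exists_injOn (fun x => g x / 2) fun n =>
      (hfin (2 * n + 1)).subset fun x (hx : g x / 2 = n) => show g x ≤ 2 * n + 1 by omega
    obtain ⟨B, hB, hinjB⟩ := hF.exists_injOn (fun x => (g x + 1) / 2) fun n =>
      (hfin (2 * n)).subset fun x (hx : (g x + 1) / 2 = n) => show g x ≤ 2 * n by omega
    have hAB := hinter A hA B hB
    refine ⟨A ∩ B, hAB, (forall_nth_lt_nth_succ_iff (hinf _ hAB) f).2 ?_⟩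
    intro i hi j hj hij
    have h₁ : g i / 2 ≠ g j / 2 := fun h => hij.ne (hinjA hi.1 hj.1 h)
    have h₂ : (g i + 1) / 2 ≠ (g j + 1) / 2 := fun h => hij.ne (hinjB hi.2 hj.2 h)
    have h₃ : g i ≤ g j := hg hij.le
    exact hsep i j (by omega)
  · intro H p hfin hdisj hcover
    choose h hh using fun x => mem_iUnion.1 (hcover.symm ▸ mem_univ x : x ∈ ⋃ n, p n)
    have hp : ∀ n, ∀ x ∈ p n, h x = n := fun n x hx => by
      by_contra hne
      exact disjoint_left.1 (hdisj hne) (hh x) hx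
    obtain ⟨f, hf, hbound⟩ := exists_strictMono_bound_fibers h fun n =>
      (hfin n).subset fun x hx => hx ▸ hh x
    obtain ⟨C, hC, hlt⟩ := H f hf
    have hsep := (forall_nth_lt_nth_succ_iff (hinf C hC) f).1 hlt
    refine ⟨C, hC, fun n x hx y hy => ?_⟩
    have hxy : h x = h y := (hp n x hx.2).trans (hp n y hy.2).symm
    rcases lt_trichotomy x y with hlt' | heq | hgt
    · exact absurd (hsep x hx.1 y hy.1 hlt') (not_lt.2 (hbound x y hxy))
    · exact heq
    · exact absurd (hsep y hy.1 x hx.1 hgt) (not_lt.2 (hbound y x hxy.symm))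
end
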